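/- arXiv:1506.05389 — 2 statements merged into one kernel-verified Lean document; each statement's English description precedes it below -/
import Mathlib

section
/- Let R be a subring of a commutative ring T, and let C be an ideal of T that is contained in R (so C is a common ideal of R and T). If C contains a T-regular element (a non-zerodivisor on T), then T is an integral domain if and only if R is an integral domain. -/
/-- In a regular conductor situation (`C` a common ideal of `R ⊆ T`
containing a non-zerodivisor of `T`), `T` is a domain iff `R` is a domain. -/
theorem stmt_0 (T : Type*) [CommRing T] (R : Subring T) (C : Ideal T)
    (hCR : (C : Set T) ⊆ (R : Set T))
    (hreg : ∃ c ∈ C, c ∈ nonZeroDivisors T) :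
    IsDomain T ↔ IsDomain ↥R := by
  constructor
  · intro h
    infer_instance
  · intro h
    obtain ⟨c, hc, hn⟩ := hreg
    have hnt : Nontrivial T := R.subtype_injective.nontrivial
    have hz : ∀ x : T, x * c = 0 → x = 0 := fun x hx =>
      (mul_right_mem_nonZeroDivisors_eq_zero_iff hn).1 hx
    have hnz : NoZeroDivisors T := by
      refine ⟨fun {a b} hab => ?_⟩
      have ha : a * c ∈ R := hCR (C.mul_mem_left a hc)
      have hb : b * c ∈ R := hCR (C.mul_mem_left b hc)
      have hm : (⟨a * c, ha⟩ : R) * ⟨b * c, hb⟩ = 0 := by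
        apply Subtype.ext
        change a * c * (b * c) = 0
        calc a * c * (b * c) = a * b * (c * c) := by ring
          _ = 0 := by rw [hab, zero_mul]
      rcases mul_eq_zero.1 hm with h1 | h1
      · exact Or.inl (hz a (congrArg Subtype.val h1))
      · exact Or.inr (hz b (congrArg Subtype.val h1))
    exact NoZeroDivisors.to_isDomain T
end

section
/- Let R be a subring of a commutative ring T with a common ideal C containing a T-regular element, with T flat over R and C principal over T. If I is an ideal of R such that IT is a principal ideal of T generated by a non-zerodivisor, then Ext^i_R(I, T) ≅ T for i = 0 and Ext^i_R(I, T) = 0 for all i ≥ 1. -/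
open CategoryTheory


section aux
universe u
open TensorProduct Limits


theorem aux_equiv {R T : Type u} [CommRing R] [CommRing T] [Algebra R T] [Module.Flat R T]
    (I : Ideal R) (t : T) (ht : t ∈ nonZeroDivisors T)
    (hIT : Ideal.map (algebraMap R T) I = Ideal.span {t}) : Nonempty ((T ⊗[R] I) ≃ₗ[T] T) := by
  let φ : (T ⊗[R] I) →ₗ[T] T := LinearMap.liftBaseChange T ((Algebra.linearMap R T).comp I.subtype)
  have hφ : Function.Injective φ := by
    have h1 := Module.Flat.lTensor_preserves_injective_linearMap (M := T) I.subtype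
      I.injective_subtype
    have h2 : (φ : T ⊗[R] I → T) = (TensorProduct.rid R T) ∘ (I.subtype.lTensor T) := by
      have : φ.restrictScalars R = (TensorProduct.rid R T).toLinearMap ∘ₗ (I.subtype.lTensor T) := by
        ext x y
        simp [φ, Algebra.smul_def, mul_comm]
      funext x
      exact LinearMap.congr_fun this x
    rw [h2]
    exact (TensorProduct.rid R T).injective.comp h1
  have hr : LinearMap.range φ = Ideal.span {t} := by
    rw [← hIT]
    apply le_antisymm
    · rintro _ ⟨x, rfl⟩
      induction x with
      | zero => simp
      | add x y hx hy => rw [map_add]; exact add_mem hx hy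
      | tmul x y =>
        simp only [φ, LinearMap.liftBaseChange_tmul]
        exact Ideal.mul_mem_left _ _ (Ideal.mem_map_of_mem _ y.2)
    · refine Ideal.map_le_iff_le_comap.2 fun y hy => ⟨1 ⊗ₜ ⟨y, hy⟩, by simp [φ]⟩
  let ψ : T →ₗ[T] T := LinearMap.toSpanSingleton T T t
  have hψ : Function.Injective ψ := by
    intro a b h
    simp only [ψ, LinearMap.toSpanSingleton_apply, smul_eq_mul] at h
    exact (mul_cancel_right_mem_nonZeroDivisors ht).1 h
  have hr2 : LinearMap.range ψ = Ideal.span {t} := LinearMap.range_toSpanSingleton t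
  exact ⟨(LinearEquiv.ofInjective φ hφ).trans ((LinearEquiv.ofEq _ _ (hr.trans hr2.symm)).trans
    (LinearEquiv.ofInjective ψ hψ).symm)⟩

theorem aux_zero {R : Type u} [CommRing R] (X Y : ModuleCat.{u} R) :
    Nonempty ((((Ext R (ModuleCat.{u} R) 0).obj (Opposite.op X)).obj Y) ≃ₗ[R] (X ⟶ Y)) := by
  have : PreservesFiniteLimits ((linearYoneda R (ModuleCat.{u} R)).obj Y) := by
    have : PreservesFiniteLimits ((linearYoneda R (ModuleCat.{u} R)).obj Y ⋙ forget (ModuleCat R)) :=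
      inferInstanceAs (PreservesFiniteLimits (yoneda.obj Y))
    exact preservesFiniteLimits_of_reflects_of_preserves _ (forget (ModuleCat R))
  have := preservesFiniteColimits_rightOp ((linearYoneda R (ModuleCat.{u} R)).obj Y)
  exact ⟨((((linearYoneda R (ModuleCat.{u} R)).obj Y).rightOp.leftDerivedZeroIsoSelf.app X).unop.symm).toLinearEquiv⟩

theorem aux_hom {R T : Type u} [CommRing R] [CommRing T] [Algebra R T] (M : Type u)
    [AddCommGroup M] [Module R M] (e : (T ⊗[R] M) ≃ₗ[T] T) :
    Nonempty ((ModuleCat.of R M ⟶ ModuleCat.of R T) ≃ₗ[R] T) :=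
  ⟨ModuleCat.homLinearEquiv.trans (((LinearMap.liftBaseChangeEquiv T).trans
    ((LinearEquiv.congrLeft T T e).trans (LinearMap.ringLmapEquivSelf T T T))).restrictScalars R)⟩

theorem aux_succ' {R T : Type u} [CommRing R] [CommRing T] (f : R →+* T) :
    letI := f.toAlgebra
    ∀ [Module.Flat R T]
    (M : Type u) [AddCommGroup M] [Module R M] (e : (T ⊗[R] M) ≃ₗ[T] T) (n : ℕ),
    Subsingleton (((Ext R (ModuleCat.{u} R) (n+1)).obj
      (Opposite.op (ModuleCat.of R M))).obj (ModuleCat.of R T)) := by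
  letI := f.toAlgebra
  intro hfl M _ _ e n
  let F : ModuleCat.{u} R ⥤ ModuleCat.{u} T := ModuleCat.extendScalars.{u,u,u} f
  let G : ModuleCat.{u} T ⥤ ModuleCat.{u} R := ModuleCat.restrictScalars.{u} f
  let adj : F ⊣ G := ModuleCat.extendRestrictScalarsAdj f
  have : PreservesColimits F := adj.leftAdjoint_preservesColimits
  have : F.Additive := adj.left_adjoint_additive
  have : F.PreservesProjectiveObjects :=
    Functor.preservesProjectiveObjects_of_adjunction_of_preservesEpimorphisms adj
  have : F.PreservesHomology := by
    refine ((Functor.exact_tfae F).out 1 2).1 ?_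
    intro S hS
    rw [ShortComplex.ShortExact.moduleCat_exact_iff_function_exact] at hS ⊢
    exact Module.Flat.lTensor_exact T hS
  let P := projectiveResolution (ModuleCat.of R M)
  let Q := F.mapProjectiveResolution P
  have hp : Projective (F.obj (ModuleCat.of R M)) := by
    have h1 : Module.Projective T (T ⊗[R] M) := Module.Projective.of_equiv e.symm
    have h2 : Projective (ModuleCat.of T (T ⊗[R] M)) := (IsProjective.iff_projective _).1 h1
    exact h2
  have hz := (isZero_Ext_succ_of_projective (R := T) (F.obj (ModuleCat.of R M)) (ModuleCat.of T T) n).of_iso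
    (Q.isoExt (n+1) (ModuleCat.of T T)).symm
  rw [← HomologicalComplex.exactAt_iff_isZero_homology,
    HomologicalComplex.exactAt_iff' _ n (n+1) (n+2) (by simp) (by simp),
    ShortComplex.moduleCat_exact_iff] at hz
  have key : IsZero (((Ext R (ModuleCat.{u} R) (n+1)).obj
      (Opposite.op (ModuleCat.of R M))).obj (G.obj (ModuleCat.of T T))) := by
    refine IsZero.of_iso ?_ (P.isoExt (n+1) _)
    rw [← HomologicalComplex.exactAt_iff_isZero_homology,
      HomologicalComplex.exactAt_iff' _ n (n+1) (n+2) (by simp) (by simp),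
      ShortComplex.moduleCat_exact_iff]
    intro (x : P.complex.X (n+1) ⟶ _) (hx : P.complex.d (n+2) (n+1) ≫ x = 0)
    obtain ⟨y, hy⟩ := hz ((adj.homEquiv _ _).symm x) (by
      change F.map (P.complex.d (n+2) (n+1)) ≫ (adj.homEquiv _ _).symm x = 0
      rw [← adj.homEquiv_naturality_left_symm, hx]
      simp [adj.homEquiv_counit])
    change F.obj (P.complex.X n) ⟶ _ at y
    change F.map (P.complex.d (n+1) n) ≫ y = _ at hy
    refine ⟨adj.homEquiv _ _ y, ?_⟩
    change P.complex.d (n+1) n ≫ adj.homEquiv _ _ y = x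
    rw [← adj.homEquiv_naturality_left, hy, Equiv.apply_symm_apply]
  exact ModuleCat.subsingleton_of_isZero key

theorem aux_succ {R T : Type u} [CommRing R] [CommRing T] [h : Algebra R T] [Module.Flat R T]
    (M : Type u) [AddCommGroup M] [Module R M] (e : (T ⊗[R] M) ≃ₗ[T] T) (n : ℕ) :
    Subsingleton (((Ext R (ModuleCat.{u} R) (n+1)).obj
      (Opposite.op (ModuleCat.of R M))).obj (ModuleCat.of R T)) := by
  have hh : h = (algebraMap R T).toAlgebra := Algebra.algebra_ext _ _ (fun _ => rfl)
  generalize algebraMap R T = f at hh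
  subst hh
  exact aux_succ' f M e n

end aux

/-- condition (FP); `I` an ideal of `R` whose extension `IT` is
principal, generated by a non-zerodivisor of `T`. Then `Ext^0_R(I,T) ≅ T` and
`Ext^i_R(I,T) = 0` for `i ≥ 1`. -/
theorem stmt_6 (T : Type*) [CommRing T] (R : Subring T) (C : Ideal T)
    (hCR : (C : Set T) ⊆ (R : Set T))
    (hreg : ∃ c ∈ C, c ∈ nonZeroDivisors T)
    (hflat : Module.Flat ↥R T) (hprin : C.IsPrincipal)
    (I : Ideal ↥R) (t : T) (ht : t ∈ nonZeroDivisors T)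
    (hIT : Ideal.map (algebraMap ↥R T) I = Ideal.span {t}) :
    Nonempty
      ((((Ext ↥R (ModuleCat ↥R) 0).obj
            (Opposite.op (ModuleCat.of ↥R I))).obj (ModuleCat.of ↥R T)) ≃ₗ[↥R] T) ∧
    ∀ i : ℕ, 1 ≤ i →
      Subsingleton
        (((Ext ↥R (ModuleCat ↥R) i).obj
            (Opposite.op (ModuleCat.of ↥R I))).obj (ModuleCat.of ↥R T)) := by
  obtain ⟨e⟩ := aux_equiv I t ht hIT
  refine ⟨?_, ?_⟩
  · obtain ⟨e0⟩ := aux_zero (ModuleCat.of ↥R I) (ModuleCat.of ↥R T)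
    obtain ⟨e1⟩ := aux_hom (R := R) (T := T) I e
    exact ⟨e0.trans e1⟩
  · intro i hi
    obtain ⟨n, rfl⟩ := Nat.exists_eq_add_of_le' hi
    exact aux_succ (R := R) (T := T) I e n
end
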